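/- arXiv:2202.05969 — 2 statements merged into one kernel-verified Lean document; each statement's English description precedes it below -/
import Mathlib

section
/- Weighted L²_z bound for φ: for every λ ∈ [0,1) there exists a constant C > 0, depending only on λ, such that for every t ≥ 0, every admissible g, every n ∈ ℕ, every multi-index α with |α| = n, and every (x,y) ∈ ℝ²: ‖θ_λ ⟨r⟩ⁿ ∂^α_h φ(x,y,·)‖_{L²_z} ≤ C ⟨t⟩^{1/2} ‖θ ⟨r⟩ⁿ ∂^α_h g(x,y,·)‖_{L²_z}. -/
open MeasureTheory Filter Set

noncomputable section

/-- `⟨t⟩ = 1 + t` -/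
def angT (t : ℝ) : ℝ := 1 + t

/-- `θ_λ(z) = exp (λ z² / (8⟨t⟩))`; `θ = θ₁`. -/
def thw (t lam z : ℝ) : ℝ := Real.exp (lam * z ^ 2 / (8 * angT t))

/-- `⟨r⟩ = √(x² + y² + 1)` -/
def angR (x y : ℝ) : ℝ := Real.sqrt (x ^ 2 + y ^ 2 + 1)

/-- `Mₙ = (n+1)⁴ / n!` -/
def Mfac (n : ℕ) : ℝ := ((n : ℝ) + 1) ^ 4 / (n.factorial : ℝ)

/-- `∂_x` -/
def pdx (f : ℝ → ℝ → ℝ → ℝ) : ℝ → ℝ → ℝ → ℝ := fun x y z => deriv (fun x' => f x' y z) x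
/-- `∂_y` -/
def pdy (f : ℝ → ℝ → ℝ → ℝ) : ℝ → ℝ → ℝ → ℝ := fun x y z => deriv (fun y' => f x y' z) y
/-- `∂_z` -/
def pdz (f : ℝ → ℝ → ℝ → ℝ) : ℝ → ℝ → ℝ → ℝ := fun x y z => deriv (fun z' => f x y z') z

/-- `∂^α_h = ∂_x^{α₁} ∂_y^{α₂}` for the multi-index `α = (a, b)` -/
def pdh (a b : ℕ) (f : ℝ → ℝ → ℝ → ℝ) : ℝ → ℝ → ℝ → ℝ := pdx^[a] (pdy^[b] f)

/-- `r ∂_r = x ∂_x + y ∂_y` -/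
def rdr (f : ℝ → ℝ → ℝ → ℝ) : ℝ → ℝ → ℝ → ℝ := fun x y z => x * pdx f x y z + y * pdy f x y z

/-- weighted `L²` norm over `ℝ² × (0,∞)` of `θ_λ ⟨r⟩ⁿ f` -/
def L2w (t lam : ℝ) (n : ℕ) (f : ℝ → ℝ → ℝ → ℝ) : ℝ :=
  Real.sqrt (∫ x : ℝ, ∫ y : ℝ, ∫ z in Ioi (0 : ℝ), (thw t lam z * angR x y ^ n * f x y z) ^ 2)

/-- weighted `L²_z` norm at fixed `(x, y)` of `θ_λ ⟨r⟩ⁿ f (x, y, ·)` -/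
def L2z (t lam : ℝ) (n : ℕ) (f : ℝ → ℝ → ℝ → ℝ) (x y : ℝ) : ℝ :=
  Real.sqrt (∫ z in Ioi (0 : ℝ), (thw t lam z * angR x y ^ n * f x y z) ^ 2)

/-- mixed `L^∞_h L²_z` norm of `θ_λ ⟨r⟩ⁿ f` -/
def LIh2z (t lam : ℝ) (n : ℕ) (f : ℝ → ℝ → ℝ → ℝ) : ℝ :=
  Real.sqrt (∫ z in Ioi (0 : ℝ), (⨆ p : ℝ × ℝ, |thw t lam z * angR p.1 p.2 ^ n * f p.1 p.2 z|) ^ 2)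

/-- mixed `L²_h L^∞_z` norm of `θ_λ ⟨r⟩ⁿ f` -/
def L2hIz (t lam : ℝ) (n : ℕ) (f : ℝ → ℝ → ℝ → ℝ) : ℝ :=
  Real.sqrt (∫ x : ℝ, ∫ y : ℝ,
    (⨆ z : Ioi (0 : ℝ), |thw t lam (z : ℝ) * angR x y ^ n * f x y (z : ℝ)|) ^ 2)

/-- the primitive `φ(x,y,z) = exp(−z²/(4⟨t⟩)) ∫₀^z g(x,y,s) exp(s²/(4⟨t⟩)) ds` -/
def phiF (t : ℝ) (g : ℝ → ℝ → ℝ → ℝ) : ℝ → ℝ → ℝ → ℝ := fun x y z =>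
  Real.exp (-(z ^ 2) / (4 * angT t)) * ∫ s in (0 : ℝ)..z, g x y s * Real.exp (s ^ 2 / (4 * angT t))

/-- `u^r = ∂_z φ` -/
def ur (t : ℝ) (g : ℝ → ℝ → ℝ → ℝ) : ℝ → ℝ → ℝ → ℝ := pdz (phiF t g)

/-- `u^z = −(x∂_x + y∂_y)φ − 2φ` -/
def uzv (t : ℝ) (g : ℝ → ℝ → ℝ → ℝ) : ℝ → ℝ → ℝ → ℝ := fun x y z =>
  -(rdr (phiF t g) x y z) - 2 * phiF t g x y z

/-- smoothness together with rapid decay in `z` of all derivatives -/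
def DecaySmooth (g : ℝ → ℝ → ℝ → ℝ) : Prop :=
  ContDiff ℝ (⊤ : ℕ∞) (fun p : ℝ × ℝ × ℝ => g p.1 p.2.1 p.2.2) ∧
  ∀ a b k m : ℕ, ∀ x y : ℝ,
    Tendsto (fun z : ℝ => z ^ m * pdz^[k] (pdh a b g) x y z) atTop (nhds 0)

/-- `θ ⟨r⟩^{|α|} ∂^α_h g ∈ L²(ℝ² × (0,∞))` for every `α` -/
def L2cond (t : ℝ) (g : ℝ → ℝ → ℝ → ℝ) : Prop :=
  ∀ a b : ℕ,
    Integrable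
      (fun p : ℝ × ℝ × ℝ =>
        (thw t 1 p.2.2 * angR p.1 p.2.1 ^ (a + b) * pdh a b g p.1 p.2.1 p.2.2) ^ 2)
      (volume.restrict {p : ℝ × ℝ × ℝ | 0 < p.2.2})

/-- `θ ⟨r⟩^{|α|} ∂^α_h ∂_z g ∈ L²(ℝ² × (0,∞))` for every `α` -/
def L2condZ (t : ℝ) (g : ℝ → ℝ → ℝ → ℝ) : Prop :=
  ∀ a b : ℕ,
    Integrable
      (fun p : ℝ × ℝ × ℝ =>
        (thw t 1 p.2.2 * angR p.1 p.2.1 ^ (a + b) * pdh a b (pdz g) p.1 p.2.1 p.2.2) ^ 2)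
      (volume.restrict {p : ℝ × ℝ × ℝ | 0 < p.2.2})

/-- `X_n(g, τ)` -/
def Xel (t τ : ℝ) (g : ℝ → ℝ → ℝ → ℝ) (n : ℕ) : ℝ :=
  (∑ a ∈ Finset.range (n + 1), L2w t 1 n (pdh a (n - a) g)) * τ ^ n * Mfac n

/-- `D_n(g, τ) = X_n(∂_z g, τ)` -/
def Del (t τ : ℝ) (g : ℝ → ℝ → ℝ → ℝ) (n : ℕ) : ℝ :=
  (∑ a ∈ Finset.range (n + 1), L2w t 1 n (pdh a (n - a) (pdz g))) * τ ^ n * Mfac n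

/-- `Y_n(g, τ)` (with `Y₀ = 0`) -/
def Yel (t τ : ℝ) (g : ℝ → ℝ → ℝ → ℝ) (n : ℕ) : ℝ :=
  (∑ a ∈ Finset.range (n + 1), L2w t 1 n (pdh a (n - a) g)) * τ ^ (n - 1) * (n : ℝ) * Mfac n

/-- `‖g‖_{X_τ}` -/
def Xnrm (t τ : ℝ) (g : ℝ → ℝ → ℝ → ℝ) : ℝ := ∑' n : ℕ, Xel t τ g n
/-- `‖g‖_{D_τ}` -/
def Dnrm (t τ : ℝ) (g : ℝ → ℝ → ℝ → ℝ) : ℝ := ∑' n : ℕ, Del t τ g n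
/-- `‖g‖_{Y_τ}` -/
def Ynrm (t τ : ℝ) (g : ℝ → ℝ → ℝ → ℝ) : ℝ := ∑' n : ℕ, Yel t τ g n

/-- triple integral over `ℝ² × (0,∞)` -/
def trip (F : ℝ → ℝ → ℝ → ℝ) : ℝ := ∫ x : ℝ, ∫ y : ℝ, ∫ z in Ioi (0 : ℝ), F x y z

/-- `I^α_1` -/
def I1 (t : ℝ) (g : ℝ → ℝ → ℝ → ℝ) (a b : ℕ) : ℝ :=
  -trip fun x y z =>
    thw t 2 z * angR x y ^ (2 * (a + b)) *
      pdh a b (fun x' y' z' => ur t g x' y' z' * rdr g x' y' z') x y z * pdh a b g x y z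

/-- `I^α_2` -/
def I2 (t : ℝ) (g : ℝ → ℝ → ℝ → ℝ) (a b : ℕ) : ℝ :=
  -trip fun x y z =>
    thw t 2 z * angR x y ^ (2 * (a + b)) *
      pdh a b (fun x' y' z' => uzv t g x' y' z' * pdz g x' y' z') x y z * pdh a b g x y z

/-- `I^α_3` -/
def I3 (t : ℝ) (g : ℝ → ℝ → ℝ → ℝ) (a b : ℕ) : ℝ :=
  -trip fun x y z =>
    thw t 2 z * angR x y ^ (2 * (a + b)) *
      pdh a b (fun x' y' z' => ur t g x' y' z' ^ 2) x y z * pdh a b g x y z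

/-- `I^α_4` -/
def I4 (t : ℝ) (g : ℝ → ℝ → ℝ → ℝ) (a b : ℕ) : ℝ :=
  (1 / (2 * angT t)) * trip fun x y z =>
    thw t 2 z * angR x y ^ (2 * (a + b)) *
      pdh a b
        (fun x' y' z' =>
          uzv t g x' y' z' * pdz (fun x'' y'' w => w * phiF t g x'' y'' w) x' y' z') x y z *
      pdh a b g x y z

/-- `I^α_5` -/
def I5 (t : ℝ) (g : ℝ → ℝ → ℝ → ℝ) (a b : ℕ) : ℝ :=
  -(1 / angT t) * trip fun x y z =>
    z * thw t 2 z * angR x y ^ (2 * (a + b)) *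
      pdh a b (fun x' y' z' => ur t g x' y' z' * phiF t g x' y' z') x y z * pdh a b g x y z

/-- `I^α_6` -/
def I6 (t : ℝ) (g : ℝ → ℝ → ℝ → ℝ) (a b : ℕ) : ℝ :=
  -(1 / (2 * angT t)) * trip fun x y z =>
    z * thw t 2 z * angR x y ^ (2 * (a + b)) *
      (∫ s in Ioi z, pdh a b (fun x' y' z' => ur t g x' y' z' ^ 2) x y s) * pdh a b g x y z

/-- `I^α_7` -/
def I7 (t : ℝ) (g : ℝ → ℝ → ℝ → ℝ) (a b : ℕ) : ℝ :=
  (1 / angT t) * trip fun x y z =>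
    z * thw t 2 z * angR x y ^ (2 * (a + b)) *
      (∫ s in Ioi z, pdh a b (fun x' y' z' => pdz (ur t g) x' y' z' * uzv t g x' y' z') x y s) *
      pdh a b g x y z

/-- `∑_{|α| = n} |I^α| τⁿ Mₙ / ‖θ ⟨r⟩ⁿ ∂^α_h g‖_{L²}` (with the convention `x / 0 = 0`) -/
def Qterm (t τ : ℝ) (g : ℝ → ℝ → ℝ → ℝ) (I : ℕ → ℕ → ℝ) (n : ℕ) : ℝ :=
  ∑ a ∈ Finset.range (n + 1), |I a (n - a)| * τ ^ n * Mfac n / L2w t 1 n (pdh a (n - a) g)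

/-- `∂_t` -/
def pdt (G : ℝ → ℝ → ℝ → ℝ → ℝ) (t x y z : ℝ) : ℝ := deriv (fun t' => G t' x y z) t

/-- the good-unknown axially symmetric Prandtl equation at the point `(t, x, y, z)` -/
def GoodEq (G : ℝ → ℝ → ℝ → ℝ → ℝ) (t x y z : ℝ) : Prop :=
  pdt G t x y z
      + ur t (G t) x y z * rdr (G t) x y z
      + uzv t (G t) x y z * pdz (G t) x y z
      - pdz (pdz (G t)) x y z
      + G t x y z / angT t
      + ur t (G t) x y z ^ 2
      - 1 / (2 * angT t) * (uzv t (G t) x y z * pdz (fun x' y' w => w * phiF t (G t) x' y' w) x y z)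
      + z / angT t * (ur t (G t) x y z * phiF t (G t) x y z)
      + z / (2 * angT t) * (∫ s in Ioi z, ur t (G t) x y s ^ 2)
      - z / angT t * (∫ s in Ioi z, pdz (ur t (G t)) x y s * uzv t (G t) x y s) = 0

/-- `(∫₀ᶻ f)² ≤ z ∫₀ᶻ f²`. -/
lemma sq_intervalIntegral_le {f : ℝ → ℝ} (hf : Continuous f) {z : ℝ} (hz : 0 < z) :
    (∫ s in (0 : ℝ)..z, f s) ^ 2 ≤ z * ∫ s in (0 : ℝ)..z, f s ^ 2 := by
  set I := ∫ s in (0 : ℝ)..z, f s with hI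
  have h0 : 0 ≤ ∫ s in (0 : ℝ)..z, (z * f s - I) ^ 2 :=
    intervalIntegral.integral_nonneg hz.le fun _ _ => sq_nonneg _
  have h1 : ∫ s in (0 : ℝ)..z, (z * f s - I) ^ 2
      = z ^ 2 * (∫ s in (0 : ℝ)..z, f s ^ 2) - 2 * z * I * I + z * I ^ 2 := by
    have : (fun s => (z * f s - I) ^ 2)
        = fun s => z ^ 2 * f s ^ 2 - 2 * z * I * f s + I ^ 2 := by
      funext s; ring
    have hint : ∀ u : ℝ → ℝ, Continuous u → IntervalIntegrable u volume 0 z :=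
      fun u hu => hu.intervalIntegrable _ _
    rw [this, intervalIntegral.integral_add (hint _ (by fun_prop)) (hint _ (by fun_prop)),
      intervalIntegral.integral_sub (hint _ (by fun_prop)) (hint _ (by fun_prop)),
      intervalIntegral.integral_const_mul, intervalIntegral.integral_const_mul, ← hI]
    simp
  rw [h1] at h0
  have h2 : 0 ≤ z * (z * (∫ s in (0 : ℝ)..z, f s ^ 2) - I ^ 2) := by linarith
  linarith [nonneg_of_mul_nonneg_right h2 hz]

lemma integral_Ioi_mul_exp_neg_mul_sq {b : ℝ} (hb : 0 < b) :
    ∫ z in Ioi (0 : ℝ), z * Real.exp (-b * z ^ 2) = 1 / (2 * b) := by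
  have hd : ∀ z ∈ Ici (0 : ℝ), HasDerivAt (fun z => -(1 / (2 * b)) * Real.exp (-b * z ^ 2))
      (z * Real.exp (-b * z ^ 2)) z := by
    intro z _
    have h := ((((hasDerivAt_id z).pow 2).const_mul (-b)).exp).const_mul (-(1 / (2 * b)))
    refine h.congr_deriv ?_
    simp
    field_simp
  have hlim : Tendsto (fun z : ℝ => -(1 / (2 * b)) * Real.exp (-b * z ^ 2)) atTop (nhds 0) := by
    have : Tendsto (fun z : ℝ => -b * z ^ 2) atTop atBot :=
      (tendsto_pow_atTop two_ne_zero).const_mul_atTop_of_neg (by linarith)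
    simpa using (Real.tendsto_exp_atBot.comp this).const_mul (-(1 / (2 * b)))
  rw [integral_Ioi_of_hasDerivAt_of_tendsto' hd (integrable_mul_exp_neg_mul_sq hb).integrableOn hlim]
  simp

/-- The weighted `L²` bound for the primitive, one function of `z` at a time. -/
lemma integral_sq_weighted_primitive_le {T lam : ℝ} (hT : 0 < T) (hlam : lam < 1) {h : ℝ → ℝ}
    (hh : Continuous h)
    (hint : IntegrableOn (fun z => (Real.exp (1 * z ^ 2 / (8 * T)) * h z) ^ 2) (Ioi 0)) :
    ∫ z in Ioi (0 : ℝ), (Real.exp (lam * z ^ 2 / (8 * T)) * (Real.exp (-(z ^ 2) / (4 * T)) *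
        ∫ s in (0 : ℝ)..z, h s * Real.exp (s ^ 2 / (4 * T)))) ^ 2
      ≤ 2 * T / (1 - lam) * ∫ z in Ioi (0 : ℝ), (Real.exp (1 * z ^ 2 / (8 * T)) * h z) ^ 2 := by
  set K := ∫ z in Ioi (0 : ℝ), (Real.exp (1 * z ^ 2 / (8 * T)) * h z) ^ 2 with hK
  have hb : 0 < (1 - lam) / (4 * T) := div_pos (by linarith) (by linarith)
  have hval : 2 * T / (1 - lam) * K
      = ∫ z in Ioi (0 : ℝ), z * Real.exp (-((1 - lam) / (4 * T)) * z ^ 2) * K := by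
    rw [integral_mul_const, integral_Ioi_mul_exp_neg_mul_sq hb]
    have : 1 - lam ≠ 0 := by linarith
    field_simp
    ring
  rw [hval]
  refine integral_mono_of_nonneg (ae_of_all _ fun _ => sq_nonneg _)
    ((integrable_mul_exp_neg_mul_sq hb).integrableOn.mul_const K) ?_
  filter_upwards [ae_restrict_mem measurableSet_Ioi] with z hz
  have hz : 0 < z := hz
  have h1 := sq_intervalIntegral_le
    (f := fun s => h s * Real.exp (s ^ 2 / (4 * T))) (by fun_prop) hz
  have h2 : ∫ s in (0 : ℝ)..z, (h s * Real.exp (s ^ 2 / (4 * T))) ^ 2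
      ≤ Real.exp (z ^ 2 / (4 * T)) * K := by
    have h3 : ∫ s in (0 : ℝ)..z, (h s * Real.exp (s ^ 2 / (4 * T))) ^ 2
        ≤ ∫ s in (0 : ℝ)..z,
          Real.exp (z ^ 2 / (4 * T)) * (Real.exp (1 * s ^ 2 / (8 * T)) * h s) ^ 2 := by
      refine intervalIntegral.integral_mono_on hz.le
        (Continuous.intervalIntegrable (by fun_prop) _ _)
        (Continuous.intervalIntegrable (by fun_prop) _ _) fun s hs => ?_
      have e1 : Real.exp (1 * s ^ 2 / (8 * T)) ^ 2 = Real.exp (s ^ 2 / (4 * T)) := by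
        rw [← Real.exp_nat_mul]; congr 1; push_cast; field_simp; ring
      have e2 : Real.exp (s ^ 2 / (4 * T)) ≤ Real.exp (z ^ 2 / (4 * T)) := by
        have := hs.1; have := hs.2
        gcongr
      rw [mul_pow, mul_pow, e1]
      nlinarith [mul_le_mul_of_nonneg_right e2
        (mul_nonneg (Real.exp_pos (s ^ 2 / (4 * T))).le (sq_nonneg (h s)))]
    refine h3.trans ?_
    rw [intervalIntegral.integral_const_mul, intervalIntegral.integral_of_le hz.le]
    refine mul_le_mul_of_nonneg_left ?_ (Real.exp_pos _).le
    exact setIntegral_mono_set hint (ae_of_all _ fun _ => sq_nonneg _)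
      (LE.le.eventuallyLE Ioc_subset_Ioi_self)
  have e3 : (Real.exp (lam * z ^ 2 / (8 * T)) * Real.exp (-(z ^ 2) / (4 * T))) ^ 2
      * Real.exp (z ^ 2 / (4 * T)) = Real.exp (-((1 - lam) / (4 * T)) * z ^ 2) := by
    rw [← Real.exp_add, ← Real.exp_nat_mul, ← Real.exp_add]
    congr 1; push_cast; field_simp; ring
  calc _ = (Real.exp (lam * z ^ 2 / (8 * T)) * Real.exp (-(z ^ 2) / (4 * T))) ^ 2 *
        (∫ s in (0 : ℝ)..z, h s * Real.exp (s ^ 2 / (4 * T))) ^ 2 := by ring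
    _ ≤ (Real.exp (lam * z ^ 2 / (8 * T)) * Real.exp (-(z ^ 2) / (4 * T))) ^ 2 *
        (z * (Real.exp (z ^ 2 / (4 * T)) * K)) := by
      refine mul_le_mul_of_nonneg_left (h1.trans ?_) (sq_nonneg _)
      exact mul_le_mul_of_nonneg_left h2 hz.le
    _ = z * Real.exp (-((1 - lam) / (4 * T)) * z ^ 2) * K := by rw [← e3]; ring

/-- One-dimensional Sobolev inequality on a unit interval. -/
lemma sq_le_integral_sq_add_sq_deriv {f f' : ℝ → ℝ} (hf : ∀ x, HasDerivAt f (f' x) x)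
    (hf' : Continuous f') (x : ℝ) :
    f x ^ 2 ≤ 2 * ∫ u in x..(x + 1), (f u ^ 2 + f' u ^ 2) := by
  have hc : Continuous f := continuous_iff_continuousAt.2 fun x => (hf x).continuousAt
  have hd : ∀ u ∈ uIcc x (x + 1), HasDerivAt (fun u => -((x + 1 - u) * f u ^ 2))
      (f u ^ 2 - 2 * (x + 1 - u) * f u * f' u) u := by
    intro u _
    have h := (((hasDerivAt_id u).const_sub (x + 1)).mul ((hf u).pow 2)).neg
    refine h.congr_deriv ?_
    simp
    ring
  have hi := intervalIntegral.integral_eq_sub_of_hasDerivAt hd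
    (Continuous.intervalIntegrable (by fun_prop) _ _)
  have hx : f x ^ 2 = ∫ u in x..(x + 1), (f u ^ 2 - 2 * (x + 1 - u) * f u * f' u) := by
    rw [hi]; ring
  rw [hx, ← intervalIntegral.integral_const_mul]
  refine intervalIntegral.integral_mono_on (by linarith)
    (Continuous.intervalIntegrable (by fun_prop) _ _)
    (Continuous.intervalIntegrable (by fun_prop) _ _) fun u hu => ?_
  have h0 : 0 ≤ x + 1 - u := by linarith [hu.2]
  have h1 : x + 1 - u ≤ 1 := by linarith [hu.1]
  nlinarith [mul_nonneg h0 (sq_nonneg (f u + f' u)), sq_nonneg (f u), sq_nonneg (f' u),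
    mul_nonneg (sub_nonneg.2 h1) (sq_nonneg (f u)), mul_nonneg (sub_nonneg.2 h1) (sq_nonneg (f' u))]

/-- Two-dimensional Sobolev inequality on a unit square. -/
lemma sq_le_integral_integral_sq {f fx fy fxy : ℝ → ℝ → ℝ}
    (hx : ∀ x y, HasDerivAt (fun x' => f x' y) (fx x y) x)
    (hy : ∀ x y, HasDerivAt (fun y' => f x y') (fy x y) y)
    (hxy : ∀ x y, HasDerivAt (fun x' => fy x' y) (fxy x y) x)
    (cf : Continuous fun p : ℝ × ℝ => f p.1 p.2) (cfx : Continuous fun p : ℝ × ℝ => fx p.1 p.2)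
    (cfy : Continuous fun p : ℝ × ℝ => fy p.1 p.2)
    (cfxy : Continuous fun p : ℝ × ℝ => fxy p.1 p.2) (x y : ℝ) :
    f x y ^ 2 ≤ 4 * ∫ v in y..(y + 1), ∫ u in x..(x + 1),
      (f u v ^ 2 + fx u v ^ 2 + fy u v ^ 2 + fxy u v ^ 2) := by
  have h1 := sq_le_integral_sq_add_sq_deriv (hy x)
    (cfy.comp (by fun_prop : Continuous fun v : ℝ => (x, v))) y
  refine h1.trans ?_
  rw [show (4 : ℝ) = 2 * 2 by norm_num, mul_assoc]
  refine mul_le_mul_of_nonneg_left ?_ zero_le_two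
  rw [← intervalIntegral.integral_const_mul]
  have cS : Continuous fun p : ℝ × ℝ =>
      f p.2 p.1 ^ 2 + fx p.2 p.1 ^ 2 + fy p.2 p.1 ^ 2 + fxy p.2 p.1 ^ 2 :=
    (((((cf.pow 2).add (cfx.pow 2)).add (cfy.pow 2)).add (cfxy.pow 2)).comp continuous_swap)
  refine intervalIntegral.integral_mono_on (by linarith) (Continuous.intervalIntegrable ?_ _ _)
    (Continuous.intervalIntegrable ?_ _ _) fun v _ => ?_
  · exact ((cf.pow 2).add (cfy.pow 2)).comp (by fun_prop : Continuous fun v : ℝ => (x, v))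
  · exact continuous_const.mul
      (intervalIntegral.continuous_parametric_intervalIntegral_of_continuous' cS _ _)
  have cv : Continuous fun u : ℝ => (u, v) := by fun_prop
  have h2 := sq_le_integral_sq_add_sq_deriv (fun u => hx u v) (cfx.comp cv) x
  have h3 := sq_le_integral_sq_add_sq_deriv (fun u => hxy u v) (cfxy.comp cv) x
  refine (add_le_add h2 h3).trans (le_of_eq ?_)
  have i1 : IntervalIntegrable (fun u => f u v ^ 2 + fx u v ^ 2) volume x (x + 1) :=
    (((cf.pow 2).add (cfx.pow 2)).comp cv).intervalIntegrable _ _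
  have i2 : IntervalIntegrable (fun u => fy u v ^ 2 + fxy u v ^ 2) volume x (x + 1) :=
    (((cfy.pow 2).add (cfxy.pow 2)).comp cv).intervalIntegrable _ _
  rw [← mul_add, ← intervalIntegral.integral_add i1 i2]
  congr 1
  refine intervalIntegral.integral_congr fun u _ => ?_
  ring

/-- Joint smoothness of a function of three real variables. -/
def Smooth3 (f : ℝ → ℝ → ℝ → ℝ) : Prop :=
  ContDiff ℝ (⊤ : ℕ∞) (fun p : ℝ × ℝ × ℝ => f p.1 p.2.1 p.2.2)

section Smooth3

variable {f : ℝ → ℝ → ℝ → ℝ}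

lemma Smooth3.hasDerivAt_x_fderiv (hf : Smooth3 f) (x y z : ℝ) :
    HasDerivAt (fun x' => f x' y z)
      (fderiv ℝ (fun p : ℝ × ℝ × ℝ => f p.1 p.2.1 p.2.2) (x, y, z) (1, 0, 0)) x :=
  HasFDerivAt.comp_hasDerivAt (l := fun p : ℝ × ℝ × ℝ => f p.1 p.2.1 p.2.2)
    (f := fun x' => (x', y, z)) x ((hf.differentiable (by simp)) (x, y, z)).hasFDerivAt
    ((hasDerivAt_id x).prodMk (hasDerivAt_const x (y, z)))

lemma Smooth3.hasDerivAt_y_fderiv (hf : Smooth3 f) (x y z : ℝ) :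
    HasDerivAt (fun y' => f x y' z)
      (fderiv ℝ (fun p : ℝ × ℝ × ℝ => f p.1 p.2.1 p.2.2) (x, y, z) (0, 1, 0)) y :=
  HasFDerivAt.comp_hasDerivAt (l := fun p : ℝ × ℝ × ℝ => f p.1 p.2.1 p.2.2)
    (f := fun y' => (x, y', z)) y ((hf.differentiable (by simp)) (x, y, z)).hasFDerivAt
    ((hasDerivAt_const y x).prodMk ((hasDerivAt_id y).prodMk (hasDerivAt_const y z)))

lemma Smooth3.pdx_eq (hf : Smooth3 f) : pdx f = fun x y z =>
    fderiv ℝ (fun p : ℝ × ℝ × ℝ => f p.1 p.2.1 p.2.2) (x, y, z) (1, 0, 0) := by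
  funext x y z; exact (hf.hasDerivAt_x_fderiv x y z).deriv

lemma Smooth3.pdy_eq (hf : Smooth3 f) : pdy f = fun x y z =>
    fderiv ℝ (fun p : ℝ × ℝ × ℝ => f p.1 p.2.1 p.2.2) (x, y, z) (0, 1, 0) := by
  funext x y z; exact (hf.hasDerivAt_y_fderiv x y z).deriv

lemma Smooth3.hasDerivAt_x (hf : Smooth3 f) (x y z : ℝ) :
    HasDerivAt (fun x' => f x' y z) (pdx f x y z) x := by
  rw [hf.pdx_eq]; exact hf.hasDerivAt_x_fderiv x y z

lemma Smooth3.hasDerivAt_y (hf : Smooth3 f) (x y z : ℝ) :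
    HasDerivAt (fun y' => f x y' z) (pdy f x y z) y := by
  rw [hf.pdy_eq]; exact hf.hasDerivAt_y_fderiv x y z

lemma Smooth3.pdx (hf : Smooth3 f) : Smooth3 (pdx f) := by
  rw [hf.pdx_eq]
  exact (ContDiff.fderiv_right hf (by simp)).clm_apply contDiff_const

lemma Smooth3.pdy (hf : Smooth3 f) : Smooth3 (pdy f) := by
  rw [hf.pdy_eq]
  exact (ContDiff.fderiv_right hf (by simp)).clm_apply contDiff_const

lemma Smooth3.pdy_pdx_comm (hf : Smooth3 f) :
    _root_.pdy (_root_.pdx f) = _root_.pdx (_root_.pdy f) := by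
  have hd : Differentiable ℝ (fderiv ℝ (fun p : ℝ × ℝ × ℝ => f p.1 p.2.1 p.2.2)) :=
    (ContDiff.fderiv_right (m := (⊤ : ℕ∞)) hf (by simp)).differentiable (by simp)
  rw [hf.pdx.pdy_eq, hf.pdy.pdx_eq, hf.pdx_eq, hf.pdy_eq]
  funext x y z
  have hs := (hf.contDiffAt (x := (x, y, z))).isSymmSndFDerivAt (by
    simpa using (WithTop.coe_le_coe.2 le_top : ((2 : ℕ∞) : WithTop ℕ∞) ≤ ((⊤ : ℕ∞) : WithTop ℕ∞)))
  have key : ∀ v w : ℝ × ℝ × ℝ,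
      fderiv ℝ (fun p : ℝ × ℝ × ℝ => fderiv ℝ (fun p : ℝ × ℝ × ℝ => f p.1 p.2.1 p.2.2) p v)
        (x, y, z) w
      = fderiv ℝ (fderiv ℝ (fun p : ℝ × ℝ × ℝ => f p.1 p.2.1 p.2.2)) (x, y, z) w v := by
    intro v w
    rw [fderiv_clm_apply (hd _) (differentiableAt_const v)]
    simp
  exact (key _ _).trans ((hs _ _).trans (key _ _).symm)

lemma Smooth3.iterate_pdx (hf : Smooth3 f) (a : ℕ) : Smooth3 (_root_.pdx^[a] f) := by
  induction a with
  | zero => exact hf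
  | succ k ih => rw [Function.iterate_succ_apply']; exact ih.pdx

lemma Smooth3.iterate_pdy (hf : Smooth3 f) (b : ℕ) : Smooth3 (_root_.pdy^[b] f) := by
  induction b with
  | zero => exact hf
  | succ k ih => rw [Function.iterate_succ_apply']; exact ih.pdy

lemma Smooth3.pdh (hf : Smooth3 f) (a b : ℕ) : Smooth3 (pdh a b f) :=
  (hf.iterate_pdy b).iterate_pdx a

lemma pdx_pdh (a b : ℕ) : pdx (pdh a b f) = pdh (a + 1) b f :=
  (Function.iterate_succ_apply' pdx a _).symm

lemma Smooth3.pdy_iterate_pdx (hf : Smooth3 f) (a : ℕ) :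
    _root_.pdy (_root_.pdx^[a] f) = _root_.pdx^[a] (_root_.pdy f) := by
  induction a with
  | zero => rfl
  | succ k ih =>
    rw [Function.iterate_succ_apply', Function.iterate_succ_apply',
      (hf.iterate_pdx k).pdy_pdx_comm, ih]

lemma Smooth3.pdy_pdh (hf : Smooth3 f) (a b : ℕ) :
    _root_.pdy (_root_.pdh a b f) = _root_.pdh a (b + 1) f := by
  unfold _root_.pdh
  rw [(hf.iterate_pdy b).pdy_iterate_pdx, Function.iterate_succ_apply']

/-- Differentiation under an interval integral with jointly continuous derivative. -/
lemma hasDerivAt_intervalIntegral_of_continuous {F F' : ℝ → ℝ → ℝ} (a b x₀ : ℝ)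
    (hF : Continuous fun p : ℝ × ℝ => F p.1 p.2) (hF' : Continuous fun p : ℝ × ℝ => F' p.1 p.2)
    (h : ∀ x s, HasDerivAt (fun x' => F x' s) (F' x s) x) :
    HasDerivAt (fun x => ∫ s in a..b, F x s) (∫ s in a..b, F' x₀ s) x₀ := by
  obtain ⟨C, hC⟩ := ((isCompact_Icc (a := x₀ - 1) (b := x₀ + 1)).prod
    (isCompact_uIcc (a := a) (b := b))).exists_bound_of_continuousOn hF'.continuousOn
  have cs : ∀ x : ℝ, Continuous fun s : ℝ => (x, s) := fun x => by fun_prop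
  refine (intervalIntegral.hasDerivAt_integral_of_dominated_loc_of_deriv_le
    (s := Icc (x₀ - 1) (x₀ + 1)) (bound := fun _ => C) (F' := F')
    (Icc_mem_nhds (by linarith) (by linarith)) ?_ ?_ ?_ ?_ ?_ ?_).2
  · exact Eventually.of_forall fun x => (hF.comp (cs x)).aestronglyMeasurable
  · exact (hF.comp (cs x₀)).intervalIntegrable _ _
  · exact (hF'.comp (cs x₀)).aestronglyMeasurable
  · exact ae_of_all _ fun s hs x hx => hC (x, s) ⟨hx, uIoc_subset_uIcc hs⟩
  · exact intervalIntegrable_const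
  · exact ae_of_all _ fun s _ x _ => h x s

lemma Smooth3.pdx_phiF (hf : Smooth3 f) (t : ℝ) :
    _root_.pdx (phiF t f) = phiF t (_root_.pdx f) := by
  funext x y z
  have c : Continuous fun p : ℝ × ℝ => (p.1, y, p.2) := by fun_prop
  have ce : Continuous fun p : ℝ × ℝ => Real.exp (p.2 ^ 2 / (4 * angT t)) := by fun_prop
  exact ((hasDerivAt_intervalIntegral_of_continuous
    (F := fun x s => f x y s * Real.exp (s ^ 2 / (4 * angT t))) 0 z x
    ((hf.continuous.comp c).mul ce) ((hf.pdx.continuous.comp c).mul ce)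
    fun x s => (hf.hasDerivAt_x x y s).mul_const _).const_mul _).deriv

lemma Smooth3.pdy_phiF (hf : Smooth3 f) (t : ℝ) :
    _root_.pdy (phiF t f) = phiF t (_root_.pdy f) := by
  funext x y z
  have c : Continuous fun p : ℝ × ℝ => (x, p.1, p.2) := by fun_prop
  have ce : Continuous fun p : ℝ × ℝ => Real.exp (p.2 ^ 2 / (4 * angT t)) := by fun_prop
  exact ((hasDerivAt_intervalIntegral_of_continuous
    (F := fun y s => f x y s * Real.exp (s ^ 2 / (4 * angT t))) 0 z y
    ((hf.continuous.comp c).mul ce) ((hf.pdy.continuous.comp c).mul ce)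
    fun y s => (hf.hasDerivAt_y x y s).mul_const _).const_mul _).deriv

lemma Smooth3.pdh_phiF (hf : Smooth3 f) (t : ℝ) (a b : ℕ) :
    _root_.pdh a b (phiF t f) = phiF t (_root_.pdh a b f) := by
  have hy : _root_.pdy^[b] (phiF t f) = phiF t (_root_.pdy^[b] f) := by
    induction b with
    | zero => rfl
    | succ k ih =>
      rw [Function.iterate_succ_apply', ih, (hf.iterate_pdy k).pdy_phiF,
        Function.iterate_succ_apply']
  unfold _root_.pdh
  rw [hy]
  induction a with
  | zero => rfl
  | succ k ih =>
    rw [Function.iterate_succ_apply', ih, ((hf.iterate_pdy b).iterate_pdx k).pdx_phiF,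
      Function.iterate_succ_apply']

end Smooth3

lemma one_le_angR (x y : ℝ) : 1 ≤ angR x y :=
  Real.one_le_sqrt.2 (by nlinarith [sq_nonneg x, sq_nonneg y])

/-- Dropping the weight `⟨r⟩^{|α|} ≥ 1` from `L2cond`. -/
lemma L2cond.integrable {t : ℝ} {g : ℝ → ℝ → ℝ → ℝ} (hg : L2cond t g) (hs : Smooth3 g) (a b : ℕ) :
    Integrable (fun p : ℝ × ℝ × ℝ => (thw t 1 p.2.2 * pdh a b g p.1 p.2.1 p.2.2) ^ 2)
      (volume.restrict {p : ℝ × ℝ × ℝ | 0 < p.2.2}) := by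
  refine (hg a b).mono' ?_ (ae_of_all _ fun p => ?_)
  · have := (hs.pdh a b).continuous
    have ct : Continuous fun p : ℝ × ℝ × ℝ => thw t 1 p.2.2 := by unfold thw; fun_prop
    exact ((ct.mul this).pow 2).aestronglyMeasurable
  · rw [Real.norm_of_nonneg (sq_nonneg _), mul_right_comm, mul_pow _ (angR _ _ ^ _)]
    exact le_mul_of_one_le_right (sq_nonneg _)
      (one_le_pow₀ (one_le_pow₀ (one_le_angR _ _)))

/-- By the Sobolev inequality in `(x, y)`, `θ ∂^α_h g(x,y,·)` is square integrable for every
`(x, y)`. -/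
lemma L2cond.integrableOn_slice {t : ℝ} {g : ℝ → ℝ → ℝ → ℝ} (hg : L2cond t g) (hs : Smooth3 g)
    (a b : ℕ) (x y : ℝ) :
    IntegrableOn (fun z => (thw t 1 z * pdh a b g x y z) ^ 2) (Ioi 0) := by
  have ct : Continuous fun z : ℝ => thw t 1 z := by unfold thw; fun_prop
  have hS := (((hg.integrable hs a b).add (hg.integrable hs (a + 1) b)).add
    (hg.integrable hs a (b + 1))).add (hg.integrable hs (a + 1) (b + 1))
  have hset : {p : ℝ × ℝ × ℝ | 0 < p.2.2} = univ ×ˢ (univ ×ˢ Ioi (0 : ℝ)) := by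
    ext p; simp
  have hle : (volume.restrict (Ioc x (x + 1))).prod ((volume.restrict (Ioc y (y + 1))).prod
      (volume.restrict (Ioi (0 : ℝ)))) ≤ volume.restrict {p : ℝ × ℝ × ℝ | 0 < p.2.2} := by
    rw [hset, Measure.prod_restrict, Measure.prod_restrict]
    exact Measure.restrict_mono (by gcongr <;> exact subset_univ _) le_rfl
  have hI := ((hS.mono_measure hle).integral_prod_right.integral_prod_right).const_mul 4
  refine hI.mono' ?_ (ae_of_all _ fun z => ?_)
  · have cz : Continuous fun z : ℝ => (x, y, z) := by fun_prop
    exact ((ct.mul ((hs.pdh a b).continuous.comp cz)).pow 2).aestronglyMeasurable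
  · have cz : Continuous fun p : ℝ × ℝ => (p.1, p.2, z) := by fun_prop
    have hcont : ∀ a b : ℕ, Continuous fun p : ℝ × ℝ => thw t 1 z * pdh a b g p.1 p.2 z :=
      fun a b => continuous_const.mul ((hs.pdh a b).continuous.comp cz)
    have hdx : ∀ b x y, HasDerivAt (fun x' => thw t 1 z * pdh a b g x' y z)
        (thw t 1 z * pdh (a + 1) b g x y z) x := fun b x y => by
      rw [← pdx_pdh]; exact ((hs.pdh a b).hasDerivAt_x x y z).const_mul _
    have hdy : ∀ x y, HasDerivAt (fun y' => thw t 1 z * pdh a b g x y' z)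
        (thw t 1 z * pdh a (b + 1) g x y z) y := fun x y => by
      rw [← hs.pdy_pdh]; exact ((hs.pdh a b).hasDerivAt_y x y z).const_mul _
    have key := sq_le_integral_integral_sq (hdx b) hdy (hdx (b + 1)) (hcont a b)
      (hcont (a + 1) b) (hcont a (b + 1)) (hcont (a + 1) (b + 1)) x y
    rw [Real.norm_of_nonneg (sq_nonneg _)]
    simp only [intervalIntegral.integral_of_le (show x ≤ x + 1 by linarith),
      intervalIntegral.integral_of_le (show y ≤ y + 1 by linarith)] at key
    exact key

lemma L2z_eq (t lam : ℝ) (n : ℕ) (f : ℝ → ℝ → ℝ → ℝ) (x y : ℝ) :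
    L2z t lam n f x y =
      angR x y ^ n * Real.sqrt (∫ z in Ioi (0 : ℝ), (thw t lam z * f x y z) ^ 2) := by
  have h0 : 0 ≤ angR x y ^ n := pow_nonneg (Real.sqrt_nonneg _) n
  have : ∀ z, (thw t lam z * angR x y ^ n * f x y z) ^ 2
      = (angR x y ^ n) ^ 2 * (thw t lam z * f x y z) ^ 2 := fun z => by ring
  unfold L2z
  simp_rw [this]
  rw [integral_const_mul, Real.sqrt_mul (sq_nonneg _), Real.sqrt_sq h0]

/-- weighted `L²_z` bound for `φ`. -/
theorem L2z_bound_phi :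
    ∀ lam : ℝ, 0 ≤ lam → lam < 1 → ∃ C : ℝ, 0 < C ∧
      ∀ t : ℝ, 0 ≤ t → ∀ g : ℝ → ℝ → ℝ → ℝ, DecaySmooth g → L2cond t g →
        ∀ n a b : ℕ, a + b = n → ∀ x y : ℝ,
          L2z t lam n (pdh a b (phiF t g)) x y ≤
            C * angT t ^ ((1 : ℝ) / 2) * L2z t 1 n (pdh a b g) x y := by
  intro lam _ hlam
  have hc : 0 < 2 / (1 - lam) := div_pos two_pos (by linarith)
  refine ⟨Real.sqrt (2 / (1 - lam)), Real.sqrt_pos.2 hc, ?_⟩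
  intro t ht g hg hg2 n a b _ x y
  have hs : Smooth3 g := hg.1
  have hT : 0 < angT t := by unfold angT; linarith
  have cz : Continuous fun z : ℝ => (x, y, z) := by fun_prop
  have key := integral_sq_weighted_primitive_le hT hlam
    ((hs.pdh a b).continuous.comp cz) (hg2.integrableOn_slice hs a b x y)
  rw [hs.pdh_phiF, L2z_eq, L2z_eq, ← Real.sqrt_eq_rpow, ← Real.sqrt_mul hc.le,
    mul_left_comm, ← Real.sqrt_mul (mul_pos hc hT).le]
  refine mul_le_mul_of_nonneg_left (Real.sqrt_le_sqrt ?_) (pow_nonneg (Real.sqrt_nonneg _) n)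
  rw [div_mul_eq_mul_div]
  exact key
end
end

section
/- Weighted L² bound for u^r in terms of g: for every λ ∈ [0,1) there exists a constant C > 0, depending only on λ, such that for every t ≥ 0, every admissible g, every n ∈ ℕ, and every multi-index α with |α| = n: ‖θ_λ ⟨r⟩ⁿ ∂^α_h u^r‖_{L²} ≤ C ‖θ ⟨r⟩ⁿ ∂^α_h g‖_{L²}. -/
open MeasureTheory Filter Set

noncomputable section

/-- Differentiation under the integral sign over a compact interval. -/
theorem hasDerivAt_intervalIntegral_of_contDiff {F : ℝ × ℝ → ℝ} (hF : ContDiff ℝ 1 F)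
    (a b x : ℝ) :
    HasDerivAt (fun x' => ∫ s in a..b, F (x', s))
      (∫ s in a..b, deriv (fun x' => F (x', s)) x) x := by
  have hd (x' s : ℝ) : HasDerivAt (fun u => F (u, s)) (fderiv ℝ F (x', s) (1, 0)) x' := by
    have h₁ : HasDerivAt (fun u : ℝ => (u, s)) ((1 : ℝ), (0 : ℝ)) x' :=
      (hasDerivAt_id x').prodMk (hasDerivAt_const x' s)
    exact ((hF.differentiable one_ne_zero) (x', s)).hasFDerivAt.comp_hasDerivAt x' h₁
  have hc : Continuous fun p : ℝ × ℝ => fderiv ℝ F p (1, 0) :=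
    (hF.continuous_fderiv one_ne_zero).clm_apply continuous_const
  simp_rw [fun s => (hd x s).deriv]
  obtain ⟨M, hM⟩ := ((isCompact_closedBall x 1).prod isCompact_uIcc).exists_bound_of_continuousOn
    (f := fun p : ℝ × ℝ => fderiv ℝ F p (1, 0)) (s := Metric.closedBall x 1 ×ˢ uIcc a b)
    hc.continuousOn
  have hsec (x' : ℝ) : Continuous fun s => F (x', s) := hF.continuous.comp (by fun_prop)
  refine (intervalIntegral.hasDerivAt_integral_of_dominated_loc_of_deriv_le
    (F' := fun x' s => fderiv ℝ F (x', s) (1, 0)) (bound := fun _ => M)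
    (Metric.closedBall_mem_nhds x one_pos)
    (Eventually.of_forall fun x' => (hsec x').aestronglyMeasurable)
    ((hsec x).intervalIntegrable _ _)
    (hc.comp (by fun_prop : Continuous fun s : ℝ => (x, s))).aestronglyMeasurable
    (Eventually.of_forall fun s hs x' hx' => hM (x', s) ⟨hx', uIoc_subset_uIcc hs⟩)
    intervalIntegrable_const
    (Eventually.of_forall fun s _ x' _ => hd x' s)).2

/-- Joint smoothness of a function of three real variables. -/
def JointSmooth (g : ℝ → ℝ → ℝ → ℝ) : Prop :=
  ContDiff ℝ (⊤ : ℕ∞) (fun p : ℝ × ℝ × ℝ => g p.1 p.2.1 p.2.2)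

theorem JointSmooth.comp {g : ℝ → ℝ → ℝ → ℝ} (hg : JointSmooth g) {E : Type*}
    [NormedAddCommGroup E] [NormedSpace ℝ E] {n : ℕ∞} {u v w : E → ℝ} (hu : ContDiff ℝ n u)
    (hv : ContDiff ℝ n v) (hw : ContDiff ℝ n w) :
    ContDiff ℝ n (fun e => g (u e) (v e) (w e)) :=
  (hg.of_le (by exact_mod_cast le_top)).comp (hu.prodMk (hv.prodMk hw))

theorem JointSmooth.pdx {g : ℝ → ℝ → ℝ → ℝ} (hg : JointSmooth g) : JointSmooth (pdx g) := by
  have h : (fun p : ℝ × ℝ × ℝ => _root_.pdx g p.1 p.2.1 p.2.2) =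
      fun p => fderiv ℝ (fun p : ℝ × ℝ × ℝ => g p.1 p.2.1 p.2.2) p (1, 0, 0) := by
    funext ⟨x, y, z⟩
    have h₁ : HasDerivAt (fun u : ℝ => (u, y, z)) ((1 : ℝ), (0 : ℝ), (0 : ℝ)) x :=
      (hasDerivAt_id x).prodMk (hasDerivAt_const x (y, z))
    exact (((ContDiff.differentiable hg (by simp)) (x, y, z)).hasFDerivAt.comp_hasDerivAt x h₁).deriv
  unfold JointSmooth
  rw [h]
  exact (ContDiff.fderiv_right hg (by simp)).clm_apply contDiff_const

theorem JointSmooth.pdy {g : ℝ → ℝ → ℝ → ℝ} (hg : JointSmooth g) : JointSmooth (pdy g) := by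
  have h : (fun p : ℝ × ℝ × ℝ => _root_.pdy g p.1 p.2.1 p.2.2) =
      fun p => fderiv ℝ (fun p : ℝ × ℝ × ℝ => g p.1 p.2.1 p.2.2) p (0, 1, 0) := by
    funext ⟨x, y, z⟩
    have h₁ : HasDerivAt (fun u : ℝ => (x, u, z)) ((0 : ℝ), (1 : ℝ), (0 : ℝ)) y :=
      (hasDerivAt_const y x).prodMk ((hasDerivAt_id y).prodMk (hasDerivAt_const y z))
    exact (((ContDiff.differentiable hg (by simp)) (x, y, z)).hasFDerivAt.comp_hasDerivAt y h₁).deriv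
  unfold JointSmooth
  rw [h]
  exact (ContDiff.fderiv_right hg (by simp)).clm_apply contDiff_const

theorem JointSmooth.pdh {g : ℝ → ℝ → ℝ → ℝ} (hg : JointSmooth g) (a b : ℕ) :
    JointSmooth (pdh a b g) := by
  have hy : JointSmooth (_root_.pdy^[b] g) := by
    induction b with
    | zero => exact hg
    | succ b ih => rw [Function.iterate_succ_apply']; exact ih.pdy
  induction a with
  | zero => exact hy
  | succ a ih => rw [_root_.pdh, Function.iterate_succ_apply']; exact ih.pdx

theorem hasDerivAt_gaussian_neg {T : ℝ} (hT : T ≠ 0) (z : ℝ) :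
    HasDerivAt (fun z => Real.exp (-(z ^ 2) / (4 * T)))
      (-(z / (2 * T)) * Real.exp (-(z ^ 2) / (4 * T))) z := by
  have h := (((hasDerivAt_pow 2 z).neg).div_const (4 * T)).exp
  convert! h using 1
  simp only [Pi.neg_apply]
  field_simp
  norm_num
  ring

theorem ur_eq {t : ℝ} (ht : 0 ≤ t) {g : ℝ → ℝ → ℝ → ℝ} (hg : JointSmooth g) :
    ur t g = fun x y z => g x y z - z / (2 * angT t) * phiF t g x y z := by
  have hT : angT t ≠ 0 := by unfold angT; positivity
  funext x y z
  have hc : Continuous fun s => g x y s * Real.exp (s ^ 2 / (4 * angT t)) :=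
    (hg.comp (n := 0) contDiff_const contDiff_const contDiff_id).continuous.mul (by fun_prop)
  have hi : HasDerivAt (fun z => ∫ s in (0 : ℝ)..z, g x y s * Real.exp (s ^ 2 / (4 * angT t)))
      (g x y z * Real.exp (z ^ 2 / (4 * angT t))) z :=
    intervalIntegral.integral_hasDerivAt_right (hc.intervalIntegrable _ _)
      (hc.stronglyMeasurableAtFilter _ _) hc.continuousAt
  refine ((hasDerivAt_gaussian_neg hT z).mul hi).deriv.trans ?_
  have he : Real.exp (-(z ^ 2) / (4 * angT t)) * Real.exp (z ^ 2 / (4 * angT t)) = 1 := by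
    rw [← Real.exp_add]; simp [neg_div]
  rw [phiF]
  linear_combination g x y z * he

theorem hasDerivAt_phiF_x (t : ℝ) {g : ℝ → ℝ → ℝ → ℝ} (hg : JointSmooth g) (x y z : ℝ) :
    HasDerivAt (fun x' => phiF t g x' y z) (phiF t (pdx g) x y z) x := by
  have hF : ContDiff ℝ 1 fun p : ℝ × ℝ => g p.1 y p.2 * Real.exp (p.2 ^ 2 / (4 * angT t)) :=
    (hg.comp (n := 1) contDiff_fst contDiff_const contDiff_snd).mul (by fun_prop)
  have h := (hasDerivAt_intervalIntegral_of_contDiff hF 0 z x).const_mul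
    (Real.exp (-(z ^ 2) / (4 * angT t)))
  simp only [deriv_mul_const_field] at h
  exact h

theorem hasDerivAt_phiF_y (t : ℝ) {g : ℝ → ℝ → ℝ → ℝ} (hg : JointSmooth g) (x y z : ℝ) :
    HasDerivAt (fun y' => phiF t g x y' z) (phiF t (pdy g) x y z) y := by
  have hF : ContDiff ℝ 1 fun p : ℝ × ℝ => g x p.1 p.2 * Real.exp (p.2 ^ 2 / (4 * angT t)) :=
    (hg.comp (n := 1) contDiff_const contDiff_fst contDiff_snd).mul (by fun_prop)
  have h := (hasDerivAt_intervalIntegral_of_contDiff hF 0 z y).const_mul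
    (Real.exp (-(z ^ 2) / (4 * angT t)))
  simp only [deriv_mul_const_field] at h
  exact h

theorem pdx_ur {t : ℝ} (ht : 0 ≤ t) {g : ℝ → ℝ → ℝ → ℝ} (hg : JointSmooth g) :
    pdx (ur t g) = ur t (pdx g) := by
  rw [ur_eq ht hg, ur_eq ht hg.pdx]
  funext x y z
  have hd : HasDerivAt (fun x' => g x' y z) (pdx g x y z) x :=
    (((hg.comp (n := 1) contDiff_id contDiff_const contDiff_const).differentiable
      one_ne_zero) x).hasDerivAt
  exact (hd.sub ((hasDerivAt_phiF_x t hg x y z).const_mul (z / (2 * angT t)))).deriv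

theorem pdy_ur {t : ℝ} (ht : 0 ≤ t) {g : ℝ → ℝ → ℝ → ℝ} (hg : JointSmooth g) :
    pdy (ur t g) = ur t (pdy g) := by
  rw [ur_eq ht hg, ur_eq ht hg.pdy]
  funext x y z
  have hd : HasDerivAt (fun y' => g x y' z) (pdy g x y z) y :=
    (((hg.comp (n := 1) contDiff_const contDiff_id contDiff_const).differentiable
      one_ne_zero) y).hasDerivAt
  exact (hd.sub ((hasDerivAt_phiF_y t hg x y z).const_mul (z / (2 * angT t)))).deriv

theorem pdh_ur {t : ℝ} (ht : 0 ≤ t) {g : ℝ → ℝ → ℝ → ℝ} (hg : JointSmooth g) (a b : ℕ) :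
    pdh a b (ur t g) = ur t (pdh a b g) := by
  have hy : pdy^[b] (ur t g) = ur t (pdy^[b] g) := by
    induction b with
    | zero => rfl
    | succ b ih =>
      rw [Function.iterate_succ_apply', Function.iterate_succ_apply', ih]
      exact pdy_ur ht (hg.pdh 0 b)
  induction a with
  | zero => exact hy
  | succ a ih =>
    rw [pdh, pdh, Function.iterate_succ_apply', Function.iterate_succ_apply']
    exact (congrArg pdx ih).trans (pdx_ur ht (hg.pdh a b))

/-- Cauchy–Schwarz on a compact interval. -/
theorem sq_intervalIntegral_mul_le {f k : ℝ → ℝ} (hf : Continuous f) (hk : Continuous k)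
    {a b : ℝ} (hab : a ≤ b) :
    (∫ s in a..b, f s * k s) ^ 2 ≤ (∫ s in a..b, f s ^ 2) * ∫ s in a..b, k s ^ 2 := by
  have h : discrim (∫ s in a..b, f s ^ 2) (2 * ∫ s in a..b, f s * k s) (∫ s in a..b, k s ^ 2)
      ≤ 0 := by
    refine discrim_le_zero fun u => ?_
    have hnn : 0 ≤ ∫ s in a..b, (u * f s + k s) ^ 2 :=
      intervalIntegral.integral_nonneg hab fun s _ => sq_nonneg _
    have he : ∫ s in a..b, (u * f s + k s) ^ 2 =
        (u * u) * (∫ s in a..b, f s ^ 2) + (2 * u) * (∫ s in a..b, f s * k s)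
          + ∫ s in a..b, k s ^ 2 := by
      rw [← intervalIntegral.integral_const_mul, ← intervalIntegral.integral_const_mul,
        ← intervalIntegral.integral_add, ← intervalIntegral.integral_add]
      · congr 1; funext s; ring
      all_goals exact Continuous.intervalIntegrable (by fun_prop) _ _
    linarith
  rw [discrim] at h
  linarith

theorem integral_pow_three_mul_gaussian {μ : ℝ} (hμ : 0 < μ) :
    ∫ z in Ioi (0 : ℝ), z ^ 3 * Real.exp (-μ * z ^ 2) = 1 / (2 * μ ^ 2) := by
  have h := integral_rpow_mul_exp_neg_mul_rpow (p := 2) (q := 3) two_pos (by norm_num) hμ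
  have hG : Real.Gamma ((3 + 1) / 2) = 1 := by
    rw [show ((3 : ℝ) + 1) / 2 = ((1 : ℕ) : ℝ) + 1 by norm_num, Real.Gamma_nat_eq_factorial]
    simp
  rw [hG, show -((3 : ℝ) + 1) / 2 = -(2 : ℕ) by norm_num, Real.rpow_neg hμ.le,
    Real.rpow_natCast] at h
  norm_cast at h
  rw [h]
  field_simp

theorem integrableOn_pow_three_mul_gaussian {μ : ℝ} (hμ : 0 < μ) :
    IntegrableOn (fun z : ℝ => z ^ 3 * Real.exp (-μ * z ^ 2)) (Ioi 0) := by
  have h := integrableOn_rpow_mul_exp_neg_mul_sq hμ (s := (3 : ℕ)) (by norm_num)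
  simpa only [Real.rpow_natCast] using h

/-- Pointwise bound for the Gaussian primitive by the weighted `L²` norm of the integrand. -/
theorem sq_integral_mul_gaussian_le {T : ℝ} (hT : 0 < T) {h : ℝ → ℝ} (hh : Continuous h)
    (hint : IntegrableOn (fun s => (Real.exp (s ^ 2 / (8 * T)) * h s) ^ 2) (Ioi 0))
    {z : ℝ} (hz : 0 < z) :
    (∫ s in (0 : ℝ)..z, h s * Real.exp (s ^ 2 / (4 * T))) ^ 2 ≤
      (∫ s in Ioi (0 : ℝ), (Real.exp (s ^ 2 / (8 * T)) * h s) ^ 2) *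
        (z * Real.exp (z ^ 2 / (4 * T))) := by
  have hexp (s : ℝ) : Real.exp (s ^ 2 / (8 * T)) ^ 2 = Real.exp (s ^ 2 / (4 * T)) := by
    rw [← Real.exp_nat_mul]; congr 1; push_cast; field_simp; ring
  have hcs := sq_intervalIntegral_mul_le (f := fun s => Real.exp (s ^ 2 / (8 * T)) * h s)
    (k := fun s => Real.exp (s ^ 2 / (8 * T))) (by fun_prop) (by fun_prop) hz.le
  have hleft : ∫ s in (0 : ℝ)..z, h s * Real.exp (s ^ 2 / (4 * T)) =
      ∫ s in (0 : ℝ)..z, Real.exp (s ^ 2 / (8 * T)) * h s * Real.exp (s ^ 2 / (8 * T)) := by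
    congr 1; funext s; rw [← hexp]; ring
  rw [hleft]
  refine hcs.trans (mul_le_mul ?_ ?_ ?_ ?_)
  · rw [intervalIntegral.integral_of_le hz.le]
    exact setIntegral_mono_set hint (Eventually.of_forall fun s => sq_nonneg _)
      (Eventually.of_forall Ioc_subset_Ioi_self)
  · calc ∫ s in (0 : ℝ)..z, Real.exp (s ^ 2 / (8 * T)) ^ 2
        ≤ ∫ _ in (0 : ℝ)..z, Real.exp (z ^ 2 / (4 * T)) := by
          refine intervalIntegral.integral_mono_on hz.le
            (Continuous.intervalIntegrable (by fun_prop) _ _) intervalIntegrable_const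
            fun s hs => ?_
          rw [hexp]
          have := hs.1
          have := hs.2
          gcongr
      _ = z * Real.exp (z ^ 2 / (4 * T)) := by simp
  · exact intervalIntegral.integral_nonneg hz.le fun s _ => sq_nonneg _
  · exact integral_nonneg fun s => sq_nonneg _

/-- One-dimensional weighted estimate for `h - z / (2T) φ_h`, with `φ_h` the Gaussian
primitive of `h`. -/
theorem integral_sq_sub_gaussian_primitive_le {T lam : ℝ} (hT : 0 < T) (hlam : lam < 1)
    {h : ℝ → ℝ} (hh : Continuous h)
    (hint : IntegrableOn (fun s => (Real.exp (s ^ 2 / (8 * T)) * h s) ^ 2) (Ioi 0)) :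
    ∫ z in Ioi (0 : ℝ), (Real.exp (lam * z ^ 2 / (8 * T)) * (h z - z / (2 * T) *
        (Real.exp (-(z ^ 2) / (4 * T)) *
          ∫ s in (0 : ℝ)..z, h s * Real.exp (s ^ 2 / (4 * T))))) ^ 2 ≤
      (2 + 4 / (1 - lam) ^ 2) * ∫ z in Ioi (0 : ℝ), (Real.exp (z ^ 2 / (8 * T)) * h z) ^ 2 := by
  set K := ∫ z in Ioi (0 : ℝ), (Real.exp (z ^ 2 / (8 * T)) * h z) ^ 2 with hK
  have h1 : 0 < 1 - lam := sub_pos.2 hlam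
  have hμ : 0 < (1 - lam) / (4 * T) := by positivity
  have hg := (integrableOn_pow_three_mul_gaussian hμ).const_mul (K / (2 * T ^ 2))
  have hsum : ∫ z in Ioi (0 : ℝ), (2 * (Real.exp (z ^ 2 / (8 * T)) * h z) ^ 2 +
      K / (2 * T ^ 2) * (z ^ 3 * Real.exp (-((1 - lam) / (4 * T)) * z ^ 2))) =
      (2 + 4 / (1 - lam) ^ 2) * K := by
    rw [integral_add (hint.const_mul 2) hg, integral_const_mul, integral_const_mul,
      integral_pow_three_mul_gaussian hμ, ← hK]
    field_simp
    ring
  rw [← hsum]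
  refine integral_mono_of_nonneg (Eventually.of_forall fun z => sq_nonneg _)
    ((hint.const_mul 2).add hg) ?_
  filter_upwards [ae_restrict_mem measurableSet_Ioi] with z hz
  have hz : 0 < z := hz
  have hJ := sq_integral_mul_gaussian_le hT hh hint hz
  rw [← hK] at hJ
  set J := ∫ s in (0 : ℝ)..z, h s * Real.exp (s ^ 2 / (4 * T))
  have hle : Real.exp (lam * z ^ 2 / (8 * T)) ≤ Real.exp (z ^ 2 / (8 * T)) := by
    gcongr
    nlinarith [sq_nonneg z]
  have hfirst : (Real.exp (lam * z ^ 2 / (8 * T)) * h z) ^ 2 ≤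
      (Real.exp (z ^ 2 / (8 * T)) * h z) ^ 2 := by
    rw [mul_pow, mul_pow]
    gcongr
  have hE : Real.exp (lam * z ^ 2 / (8 * T)) ^ 2 * Real.exp (-(z ^ 2) / (4 * T)) ^ 2 *
      Real.exp (z ^ 2 / (4 * T)) = Real.exp (-((1 - lam) / (4 * T)) * z ^ 2) := by
    rw [← Real.exp_nat_mul, ← Real.exp_nat_mul, ← Real.exp_add, ← Real.exp_add]
    congr 1
    push_cast
    field_simp
    ring
  have hsecond : (Real.exp (lam * z ^ 2 / (8 * T)) *
      (z / (2 * T) * (Real.exp (-(z ^ 2) / (4 * T)) * J))) ^ 2 ≤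
      K / (4 * T ^ 2) * (z ^ 3 * Real.exp (-((1 - lam) / (4 * T)) * z ^ 2)) := by
    calc _ = Real.exp (lam * z ^ 2 / (8 * T)) ^ 2 * (z / (2 * T)) ^ 2 *
          Real.exp (-(z ^ 2) / (4 * T)) ^ 2 * J ^ 2 := by ring
      _ ≤ Real.exp (lam * z ^ 2 / (8 * T)) ^ 2 * (z / (2 * T)) ^ 2 *
          Real.exp (-(z ^ 2) / (4 * T)) ^ 2 * (K * (z * Real.exp (z ^ 2 / (4 * T)))) := by gcongr
      _ = _ := by rw [← hE]; field_simp; ring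
  calc _ ≤ 2 * (Real.exp (lam * z ^ 2 / (8 * T)) * h z) ^ 2 +
        2 * (Real.exp (lam * z ^ 2 / (8 * T)) *
          (z / (2 * T) * (Real.exp (-(z ^ 2) / (4 * T)) * J))) ^ 2 := by
        rw [mul_sub]
        linarith [add_sq_le (a := Real.exp (lam * z ^ 2 / (8 * T)) * h z)
          (b := -(Real.exp (lam * z ^ 2 / (8 * T)) *
            (z / (2 * T) * (Real.exp (-(z ^ 2) / (4 * T)) * J))))]
    _ ≤ 2 * (Real.exp (z ^ 2 / (8 * T)) * h z) ^ 2 +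
        2 * (K / (4 * T ^ 2) * (z ^ 3 * Real.exp (-((1 - lam) / (4 * T)) * z ^ 2))) := by gcongr
    _ = _ := by field_simp; ring

/-- Weighted estimate for `ur` on a fibre `{(x, y)} × (0,∞)`. -/
theorem integral_sq_ur_le {t lam : ℝ} (ht : 0 ≤ t) (hlam : lam < 1) {g : ℝ → ℝ → ℝ → ℝ}
    (hg : JointSmooth g) (n : ℕ) {x y : ℝ}
    (hint : IntegrableOn (fun z => (thw t 1 z * angR x y ^ n * g x y z) ^ 2) (Ioi 0)) :
    ∫ z in Ioi (0 : ℝ), (thw t lam z * angR x y ^ n * ur t g x y z) ^ 2 ≤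
      (2 + 4 / (1 - lam) ^ 2) *
        ∫ z in Ioi (0 : ℝ), (thw t 1 z * angR x y ^ n * g x y z) ^ 2 := by
  have hT : 0 < angT t := by unfold angT; positivity
  have hc : Continuous fun s => angR x y ^ n * g x y s :=
    continuous_const.mul (hg.comp (n := 0) contDiff_const contDiff_const contDiff_id).continuous
  simp only [thw, one_mul, mul_assoc] at hint ⊢
  refine le_trans (le_of_eq ?_) (integral_sq_sub_gaussian_primitive_le hT hlam hc hint)
  congr 1
  funext z
  simp only [ur_eq ht hg, phiF, mul_assoc, intervalIntegral.integral_const_mul]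
  ring

theorem volume_restrict_upper_half_space :
    (volume : Measure (ℝ × ℝ × ℝ)).restrict {p | 0 < p.2.2} =
      (volume : Measure ℝ).prod ((volume : Measure ℝ).prod (volume.restrict (Ioi (0 : ℝ)))) := by
  have hs : {p : ℝ × ℝ × ℝ | 0 < p.2.2} = univ ×ˢ (univ ×ˢ Ioi 0) := by
    ext; simp
  rw [hs, Measure.volume_eq_prod, ← Measure.prod_restrict, Measure.volume_eq_prod,
    ← Measure.prod_restrict, Measure.restrict_univ]

/-- A fibrewise bound integrates to a bound of the iterated integrals. -/
theorem iterated_integral_le_of_fibre_le {f F : ℝ → ℝ → ℝ → ℝ} {c : ℝ}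
    (hf : ∀ x y z, 0 ≤ f x y z)
    (hF : Integrable (fun p : ℝ × ℝ × ℝ => F p.1 p.2.1 p.2.2)
      (volume.restrict {p : ℝ × ℝ × ℝ | 0 < p.2.2}))
    (h : ∀ x y, IntegrableOn (F x y) (Ioi 0) →
      ∫ z in Ioi (0 : ℝ), f x y z ≤ c * ∫ z in Ioi (0 : ℝ), F x y z) :
    ∫ x : ℝ, ∫ y : ℝ, ∫ z in Ioi (0 : ℝ), f x y z ≤
      c * ∫ x : ℝ, ∫ y : ℝ, ∫ z in Ioi (0 : ℝ), F x y z := by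
  rw [volume_restrict_upper_half_space] at hF
  have houter := hF.integral_prod_left
  have he : ∀ᵐ x : ℝ,
      ∫ p, F x p.1 p.2 ∂((volume : Measure ℝ).prod (volume.restrict (Ioi (0 : ℝ)))) =
        ∫ y : ℝ, ∫ z in Ioi (0 : ℝ), F x y z := by
    filter_upwards [hF.prod_right_ae] with x hx
    exact integral_prod _ hx
  rw [← integral_const_mul]
  refine integral_mono_of_nonneg
    (Eventually.of_forall fun x => integral_nonneg fun y => integral_nonneg fun z => hf x y z)
    ((houter.congr he).const_mul c) ?_
  filter_upwards [hF.prod_right_ae] with x hx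
  rw [← integral_const_mul]
  refine integral_mono_of_nonneg
    (Eventually.of_forall fun y => integral_nonneg fun z => hf x y z)
    (hx.integral_prod_left.const_mul c) ?_
  filter_upwards [hx.prod_right_ae] with y hy
  exact h x y hy

/-- weighted `L²` bound for `u^r` in terms of `g`. -/
theorem L2_bound_ur :
    ∀ lam : ℝ, 0 ≤ lam → lam < 1 → ∃ C : ℝ, 0 < C ∧
      ∀ t : ℝ, 0 ≤ t → ∀ g : ℝ → ℝ → ℝ → ℝ, DecaySmooth g → L2cond t g →
        ∀ n a b : ℕ, a + b = n →
          L2w t lam n (pdh a b (ur t g)) ≤ C * L2w t 1 n (pdh a b g) := by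
  intro lam _ hlam
  have hC : 0 < 2 + 4 / (1 - lam) ^ 2 := by positivity
  refine ⟨Real.sqrt (2 + 4 / (1 - lam) ^ 2), Real.sqrt_pos.2 hC, ?_⟩
  rintro t ht g ⟨hg, -⟩ hL2 _ a b rfl
  have hg : JointSmooth g := hg
  rw [pdh_ur ht hg, L2w, L2w, ← Real.sqrt_mul hC.le]
  exact Real.sqrt_le_sqrt (iterated_integral_le_of_fibre_le (fun x y z => sq_nonneg _) (hL2 a b)
    fun x y hxy => integral_sq_ur_le ht hlam (hg.pdh a b) (a + b) hxy)
end
end
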